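/- arXiv:2511.19086 — 2 statements merged into one kernel-verified Lean document; each statement's English description precedes it below -/
import Mathlib

section
/- Let π : X → Y be a continuous map between two compact metric spaces (X, ρ_X) and (Y, ρ_Y). For any δ > 0 there exists ε > 0 such that: for any finite list of points x_1, x_2, …, x_m ∈ X satisfying ρ_Y(π(x_i), π(x_j)) < ε for all 1 ≤ i, j ≤ m, there exist points z_1, z_2, …, z_m ∈ X such that ρ_X(x_i, z_i) < δ for all 1 ≤ i ≤ m and π(z_1) = π(z_2) = ⋯ = π(z_m). -/
/-- Lemma 3.16 of Luo: For a continuous map `π : X → Y` between compact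
metric spaces and any `δ > 0` there is `ε > 0` such that any finite list `x₁, …, xₘ` in `X`
with `dist (π xᵢ) (π xⱼ) < ε` for all `i, j` admits points `z₁, …, zₘ` with
`dist (xᵢ, zᵢ) < δ` for all `i` and `π z₁ = π z₂ = ⋯ = π zₘ`. -/
theorem stmt3
    {X Y : Type*} [MetricSpace X] [CompactSpace X] [MetricSpace Y] [CompactSpace Y]
    (π : X → Y) (hπ : Continuous π) :
    ∀ δ : ℝ, 0 < δ → ∃ ε : ℝ, 0 < ε ∧
      ∀ (m : ℕ) (x : Fin m → X),
        (∀ i j : Fin m, dist (π (x i)) (π (x j)) < ε) →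
        ∃ z : Fin m → X,
          (∀ i : Fin m, dist (x i) (z i) < δ) ∧
          (∀ i j : Fin m, π (z i) = π (z j)) := by
  intro δ hδ
  have hopen : ∀ y : Y, IsOpen (π '' (Metric.thickening δ (π ⁻¹' {y}))ᶜ)ᶜ := fun y =>
    (hπ.isClosedMap _ Metric.isOpen_thickening.isClosed_compl).isOpen_compl
  have hcov : (Set.univ : Set Y) ⊆ ⋃ y : Y, (π '' (Metric.thickening δ (π ⁻¹' {y}))ᶜ)ᶜ := by
    intro y _
    refine Set.mem_iUnion.2 ⟨y, ?_⟩
    rintro ⟨w, hw, hwy⟩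
    exact hw (Metric.self_subset_thickening hδ _ hwy)
  obtain ⟨ε, hε, H⟩ := lebesgue_number_lemma_of_metric isCompact_univ hopen hcov
  refine ⟨ε, hε, ?_⟩
  intro m x hx
  rcases Nat.eq_zero_or_pos m with rfl | hm
  · exact ⟨x, fun i => i.elim0, fun i => i.elim0⟩
  obtain ⟨y, hy⟩ := H (π (x ⟨0, hm⟩)) (Set.mem_univ _)
  have key : ∀ i, ∃ z, π z = y ∧ dist (x i) z < δ := by
    intro i
    have h1 := hy (Metric.mem_ball.2 (hx i ⟨0, hm⟩))
    have h2 : x i ∈ Metric.thickening δ (π ⁻¹' {y}) := by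
      by_contra hc
      exact h1 ⟨x i, hc, rfl⟩
    obtain ⟨z, hz, hd⟩ := Metric.mem_thickening_iff.1 h2
    exact ⟨z, hz, hd⟩
  choose z hz hd using key
  exact ⟨z, hd, fun i j => (hz i).trans (hz j).symm⟩
end

section
/- Let G be a group acting on a compact metric space X such that for each g ∈ G the map x ↦ g·x is a homeomorphism. Let h ∈ ℝ and let P : C(X) → ℝ be a function satisfying: (a) if Ω ≤ Λ pointwise then P(Ω) ≤ P(Λ); (b) P(Ω + c) = P(Ω) + c for every Ω ∈ C(X) and every constant c ∈ ℝ; (c) P(0) = h; (d) P(Λ ∘ g − Λ) = h for every Λ ∈ C(X) and every g ∈ G, where (Λ ∘ g)(x) = Λ(g·x). If μ is a finite signed Borel measure on X such that ∫_X Ω dμ ≤ P(Ω) for all Ω ∈ C(X), then μ is a G-invariant Borel probability measure. -/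
open MeasureTheory

/-- The integral of a real-valued function against a finite signed Borel measure, via its
Jordan decomposition. -/
noncomputable def signedIntegral {X : Type*} [MeasurableSpace X]
    (μ : SignedMeasure X) (f : X → ℝ) : ℝ :=
  (∫ x, f x ∂μ.toJordanDecomposition.posPart) - ∫ x, f x ∂μ.toJordanDecomposition.negPart


theorem stmt9_le_aux {X : Type*} [MetricSpace X] [CompactSpace X]
    [MeasurableSpace X] [BorelSpace X] (p n : Measure X) [IsFiniteMeasure p] [IsFiniteMeasure n]
    (H : ∀ f : C(X, ℝ), (∀ x, 0 ≤ f x) → ∫ x, f x ∂n ≤ ∫ x, f x ∂p)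
    (s : Set X) (hs : MeasurableSet s) : n s ≤ p s := by
  rw [hs.measure_eq_iSup_isClosed_of_ne_top (measure_ne_top n s)]
  refine iSup_le fun K => iSup_le fun hK => iSup_le fun hc => le_trans ?_ (measure_mono hK)
  have hp : ∀ k : ℕ, (0 : ℝ) < 1 / ((k : ℝ) + 1) := fun k => Nat.one_div_pos_of_nat
  have h1 := tendsto_integral_thickenedIndicator_of_isClosed n hc hp
    tendsto_one_div_add_atTop_nhds_zero_nat
  have h2 := tendsto_integral_thickenedIndicator_of_isClosed p hc hp
    tendsto_one_div_add_atTop_nhds_zero_nat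
  have h3 : n.real K ≤ p.real K := le_of_tendsto_of_tendsto' h1 h2 fun k =>
    H ⟨fun x => (thickenedIndicator (hp k) K x : ℝ),
      NNReal.continuous_coe.comp (thickenedIndicator (hp k) K).continuous⟩ fun x => NNReal.coe_nonneg _
  exact (ENNReal.toReal_le_toReal (measure_ne_top _ _) (measure_ne_top _ _)).1 h3

theorem stmt9_arch_aux (a h : ℝ) (H : ∀ c : ℝ, 0 ≤ c → c * a ≤ h) : a ≤ 0 := by
  by_contra! ha
  have h0 := H 0 le_rfl
  have := H ((h + 1) / a) (by apply div_nonneg <;> linarith)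
  rw [div_mul_cancel₀ _ ha.ne'] at this
  linarith

theorem stmt9_int_aux {X : Type*} [MetricSpace X] [CompactSpace X]
    [MeasurableSpace X] [BorelSpace X] (p : Measure X) [IsFiniteMeasure p] (f : C(X, ℝ)) :
    Integrable (fun x => f x) p :=
  f.continuous.integrable_of_hasCompactSupport (HasCompactSupport.of_compactSpace _)

/-- Let a group `G` act by homeomorphisms on a compact metric space `X`, let
`P : C(X) → ℝ` be monotone, translate constants, satisfy `P 0 = h` and
`P (Λ ∘ g - Λ) = h`. If a finite signed Borel measure `μ` satisfies `∫ Ω dμ ≤ P Ω` for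
every `Ω ∈ C(X)`, then `μ` is a `G`-invariant Borel probability measure. -/
theorem stmt9
    {G : Type*} [Group G]
    {X : Type*} [MetricSpace X] [CompactSpace X]
    [MeasurableSpace X] [BorelSpace X]
    [MulAction G X] (hact : ∀ g : G, Continuous fun x : X => g • x)
    (h : ℝ) (P : C(X, ℝ) → ℝ)
    (hmono : ∀ Ω Λ : C(X, ℝ), (∀ x, Ω x ≤ Λ x) → P Ω ≤ P Λ)
    (hconst : ∀ (Ω : C(X, ℝ)) (c : ℝ), P (Ω + ContinuousMap.const X c) = P Ω + c)
    (hzero : P 0 = h)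
    (hcocycle : ∀ (Λ : C(X, ℝ)) (g : G),
      P (⟨fun x => Λ (g • x), Λ.continuous.comp (hact g)⟩ - Λ) = h)
    (μ : SignedMeasure X)
    (hle : ∀ Ω : C(X, ℝ), signedIntegral μ Ω ≤ P Ω) :
    (∀ s : Set X, MeasurableSet s → 0 ≤ μ s) ∧
    μ Set.univ = 1 ∧
    (∀ (g : G) (E : Set X), MeasurableSet E → μ ((fun x : X => g • x) ⁻¹' E) = μ E) := by
  obtain ⟨p, hp⟩ : ∃ p, p = μ.toJordanDecomposition.posPart := ⟨_, rfl⟩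
  obtain ⟨n, hn⟩ : ∃ n, n = μ.toJordanDecomposition.negPart := ⟨_, rfl⟩
  have fp : IsFiniteMeasure p := by rw [hp]; infer_instance
  have fn : IsFiniteMeasure n := by rw [hn]; infer_instance
  have hμ : ∀ s, MeasurableSet s → μ s = p.real s - n.real s := by
    intro s hs
    rw [hp, hn]
    exact μ.apply_eq_posPart_real_sub_negPart_real hs
  have hI : ∀ f : C(X, ℝ), (∫ x, f x ∂p) - ∫ x, f x ∂n ≤ P f := by
    intro f
    rw [hp, hn]
    exact hle f
  have hsmul : ∀ (c : ℝ) (f : C(X, ℝ)), c * ((∫ x, f x ∂p) - ∫ x, f x ∂n) ≤ P (c • f) := by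
    intro c f
    have := hI (c • f)
    simp only [ContinuousMap.smul_apply, smul_eq_mul, integral_const_mul] at this
    linarith
  have hpos : ∀ f : C(X, ℝ), (∀ x, 0 ≤ f x) → ∫ x, f x ∂n ≤ ∫ x, f x ∂p := by
    intro f hf
    have := stmt9_arch_aux ((∫ x, f x ∂n) - ∫ x, f x ∂p) h (fun c hc => by
      have h1 := hsmul (-c) f
      have h2 := hmono ((-c) • f) 0 (fun x => by
        have := mul_nonneg hc (hf x)
        simp only [ContinuousMap.smul_apply, smul_eq_mul, ContinuousMap.zero_apply]
        linarith)
      linarith)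
    linarith
  refine ⟨?_, ?_, ?_⟩
  · intro s hs
    rw [hμ s hs, sub_nonneg]
    exact ENNReal.toReal_mono (measure_ne_top _ _) (stmt9_le_aux p n hpos s hs)
  · rw [hμ _ MeasurableSet.univ]
    have key : ∀ c : ℝ, c * ((p.real Set.univ - n.real Set.univ) - 1) ≤ h := by
      intro c
      have h1 := hI (ContinuousMap.const X c)
      have h2 := hconst 0 c
      rw [zero_add, hzero] at h2
      rw [h2] at h1
      simp only [ContinuousMap.const_apply, integral_const, smul_eq_mul] at h1
      linarith
    have h1 := stmt9_arch_aux _ h (fun c _ => key c)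
    have h2 := stmt9_arch_aux (-((p.real Set.univ - n.real Set.univ) - 1)) h
      (fun c _ => by have := key (-c); linarith)
    linarith
  · intro g E hE
    have hg : Measurable fun x : X => g • x := (hact g).measurable
    have inv : ∀ f : C(X, ℝ), (∫ x, f (g • x) ∂p) - ∫ x, f (g • x) ∂n
        = (∫ x, f x ∂p) - ∫ x, f x ∂n := by
      intro f
      have key : ∀ c : ℝ, c * (((∫ x, f (g • x) ∂p) - ∫ x, f (g • x) ∂n)
          - ((∫ x, f x ∂p) - ∫ x, f x ∂n)) ≤ h := by
        intro c
        let F : C(X, ℝ) := ⟨fun x => f (g • x), f.continuous.comp (hact g)⟩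
        have h1 := hsmul c (F - f)
        have h2 : P (c • (F - f)) = h := by
          rw [← hcocycle (c • f) g]
          congr 1
          ext x
          simp [F, mul_sub]
        rw [h2] at h1
        simp only [ContinuousMap.sub_apply] at h1
        rw [integral_sub (stmt9_int_aux p F) (stmt9_int_aux p f),
          integral_sub (stmt9_int_aux n F) (stmt9_int_aux n f)] at h1
        simp only [F, ContinuousMap.coe_mk] at h1
        linarith
      have h1 := stmt9_arch_aux _ h (fun c _ => key c)
      have h2 := stmt9_arch_aux (-(((∫ x, f (g • x) ∂p) - ∫ x, f (g • x) ∂n)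
          - ((∫ x, f x ∂p) - ∫ x, f x ∂n))) h
        (fun c _ => by have := key (-c); linarith)
      linarith
    have e : p.map (fun x : X => g • x) + n = p + n.map (fun x : X => g • x) := by
      apply ext_of_forall_integral_eq_of_IsFiniteMeasure
      intro f
      have h1 := inv f.toContinuousMap
      have i1 : ∀ (q : Measure X) [IsFiniteMeasure q], Integrable (fun x => f x) q :=
        fun q _ => stmt9_int_aux q f.toContinuousMap
      rw [integral_add_measure (i1 _) (i1 _), integral_add_measure (i1 _) (i1 _),
        integral_map hg.aemeasurable (i1 _).aestronglyMeasurable,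
        integral_map hg.aemeasurable (i1 _).aestronglyMeasurable]
      simp only [BoundedContinuousFunction.coe_toContinuousMap] at h1
      linarith
    have e2 : (p.map (fun x : X => g • x) + n).real E
        = (p + n.map (fun x : X => g • x)).real E := by rw [e]
    rw [measureReal_add_apply, measureReal_add_apply, map_measureReal_apply hg hE,
      map_measureReal_apply hg hE] at e2
    rw [hμ _ hE, hμ _ (hg hE)]
    linarith
end
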